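/- For partitions μ ⊆ λ, the Littlewood-Richardson coefficient c(λ; μ, ν) equals c(λ; ν, μ), i.e. the LR coefficient is symmetric in its two lower arguments. -/

import Mathlib

open YoungDiagram
open scoped Classical

namespace LRSkew

/-- The cells of the skew diagram `lam/mu`. -/
def skewCells (lam mu : YoungDiagram) : Finset (ℕ × ℕ) := lam.cells \ mu.cells

/-- A semistandard filling of the skew shape `lam/mu`: entries are positive exactly on the
cells of the shape, rows are weakly increasing and columns are strictly increasing. -/
def IsSSYT (lam mu : YoungDiagram) (T : ℕ × ℕ → ℕ) : Prop :=
  (∀ p, p ∈ skewCells lam mu ↔ T p ≠ 0) ∧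
  (∀ i j1 j2, (i, j1) ∈ skewCells lam mu → (i, j2) ∈ skewCells lam mu → j1 ≤ j2 →
    T (i, j1) ≤ T (i, j2)) ∧
  (∀ i1 i2 j, (i1, j) ∈ skewCells lam mu → (i2, j) ∈ skewCells lam mu → i1 < i2 →
    T (i1, j) < T (i2, j))

/-- The number of entries equal to `k` among the cells read (in the reverse reading word:
right to left along rows, top row first) up to position `(i,j)`. -/
def prefixCount (lam mu : YoungDiagram) (T : ℕ × ℕ → ℕ) (i j k : ℕ) : ℕ :=
  ((skewCells lam mu).filter fun p => (p.1 < i ∨ (p.1 = i ∧ j ≤ p.2)) ∧ T p = k).card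

/-- The reverse reading word of the filling is a lattice word. -/
def IsLattice (lam mu : YoungDiagram) (T : ℕ × ℕ → ℕ) : Prop :=
  ∀ i j k, prefixCount lam mu T i j (k + 2) ≤ prefixCount lam mu T i j (k + 1)

/-- The number of entries of the filling equal to `k`. -/
def content (lam mu : YoungDiagram) (T : ℕ × ℕ → ℕ) (k : ℕ) : ℕ :=
  ((skewCells lam mu).filter fun p => T p = k).card

/-- A Littlewood–Richardson tableau of shape `lam/mu` and content `nu`. -/
def IsLR (lam mu nu : YoungDiagram) (T : ℕ × ℕ → ℕ) : Prop :=
  IsSSYT lam mu T ∧ IsLattice lam mu T ∧ ∀ i, content lam mu T (i + 1) = nu.rowLen i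

/-- The Littlewood–Richardson coefficient `c(lam; mu, nu)`. -/
noncomputable def lrCoeff (lam mu nu : YoungDiagram) : ℕ :=
  if mu ≤ lam then {T : ℕ × ℕ → ℕ | IsLR lam mu nu T}.ncard else 0

/-- Equality of the skew Schur functions `s_{lam/mu} = s_{alp/bet}`, expressed through
their expansions into Schur functions. -/
def SchurEq (lam mu alp bet : YoungDiagram) : Prop :=
  ∀ nu : YoungDiagram, lrCoeff lam mu nu = lrCoeff alp bet nu

/-- The rectangular Young diagram `(k^l)` with `l` rows of length `k`. -/
def rect (k l : ℕ) : YoungDiagram :=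
  ⟨Finset.range l ×ˢ Finset.range k, by
    intro a b hba ha
    simp only [Finset.coe_product, Set.mem_prod, Finset.mem_coe, Finset.mem_range] at ha ⊢
    exact ⟨lt_of_le_of_lt hba.1 ha.1, lt_of_le_of_lt hba.2 ha.2⟩⟩

/-- The complement of `nu` in the rectangle `(k^l)`, rotated by 180 degrees so that it is
again a partition: its parts are `(k - nu_l, …, k - nu_1)`. -/
def complRect (k l : ℕ) (nu : YoungDiagram) : YoungDiagram :=
  ⟨(rect k l).cells.filter fun p => (l - 1 - p.1, k - 1 - p.2) ∉ nu, by
    intro a b hba ha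
    simp only [Finset.coe_filter, Set.mem_setOf_eq, mem_cells] at ha ⊢
    refine ⟨(rect k l).isLowerSet hba ha.1, fun hmem => ha.2 ?_⟩
    exact nu.isLowerSet
      (Prod.mk_le_mk.mpr ⟨Nat.sub_le_sub_left hba.1 _, Nat.sub_le_sub_left hba.2 _⟩) hmem⟩

/-- The staircase partition `(n, n-1, …, 2, 1)`. -/
def staircase (n : ℕ) : YoungDiagram :=
  ⟨(Finset.range n ×ˢ Finset.range n).filter fun p => p.1 + p.2 < n, by
    intro a b hba ha
    simp only [Finset.coe_filter, Set.mem_setOf_eq, Finset.mem_product, Finset.mem_range] at ha ⊢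
    exact ⟨⟨lt_of_le_of_lt hba.1 ha.1.1, lt_of_le_of_lt hba.2 ha.1.2⟩,
      lt_of_le_of_lt (Nat.add_le_add hba.1 hba.2) ha.2⟩⟩

/-- A basic skew diagram: no empty rows and no empty columns. -/
def IsBasic (lam mu : YoungDiagram) : Prop :=
  (∀ i, i < lam.colLen 0 → mu.rowLen i < lam.rowLen i) ∧
  (∀ j, j < lam.rowLen 0 → mu.colLen j < lam.colLen j)

/-- A (basic) skew diagram is connected iff consecutive rows share a column. -/
def IsConnectedSkew (lam mu : YoungDiagram) : Prop :=
  ∀ i, i + 1 < lam.colLen 0 → mu.rowLen i < lam.rowLen (i + 1)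

/-- The number of distinct (positive) part sizes of a partition. -/
def dp (lam : YoungDiagram) : ℕ :=
  ((Finset.range (lam.colLen 0)).image fun i => lam.rowLen i).card

/-- A partition is a rectangle: all its parts are equal. -/
def IsRect (mu : YoungDiagram) : Prop :=
  ∀ i, i < mu.colLen 0 → mu.rowLen i = mu.rowLen 0

/-- Cells of a skew diagram in the same connected component: the reflexive–transitive
closure of sharing a row or a column. -/
def SameComp (s : Finset (ℕ × ℕ)) : ℕ × ℕ → ℕ × ℕ → Prop :=
  Relation.ReflTransGen fun a b => a ∈ s ∧ b ∈ s ∧ (a.1 = b.1 ∨ a.2 = b.2)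

/-- Two finite sets of boxes agree up to translation or 180°-rotation of each connected
component independently. -/
def UpToTransRot (s t : Finset (ℕ × ℕ)) : Prop :=
  ∃ f : ℕ × ℕ → ℕ × ℕ, Set.BijOn f ↑s ↑t ∧
    ∀ p ∈ s, ∀ q ∈ s, SameComp s p q →
      (((f q).1 : ℤ) - (f p).1 = (q.1 : ℤ) - p.1 ∧ ((f q).2 : ℤ) - (f p).2 = (q.2 : ℤ) - p.2) ∨
      (((f q).1 : ℤ) - (f p).1 = (p.1 : ℤ) - q.1 ∧ ((f q).2 : ℤ) - (f p).2 = (p.2 : ℤ) - q.2)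


/-! ### Chains of partitions and toggles -/

/-- A chain of partitions from the empty one to `L`, consecutive ones differing by a
horizontal strip. -/
structure IsChain (L : ℕ → ℤ) (M : ℕ) (x : ℕ → ℕ → ℤ) : Prop where
  zero : ∀ r, x 0 r = 0
  top : ∀ k, M ≤ k → ∀ r, x k r = L r
  up : ∀ k r, x k r ≤ x (k + 1) r
  il : ∀ k r, x (k + 1) (r + 1) ≤ x k r

/-- Partial row sums. -/
def psum (x : ℕ → ℕ → ℤ) (k m : ℕ) : ℤ := ∑ r ∈ Finset.range m, x k r

theorem psum_zero (x : ℕ → ℕ → ℤ) (k : ℕ) : psum x k 0 = 0 := by simp [psum]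

theorem psum_succ (x : ℕ → ℕ → ℤ) (k m : ℕ) : psum x k (m + 1) = psum x k m + x k m := by
  simp [psum, Finset.sum_range_succ]

/-- The (truncated) Bender-Knuth toggle of level `l+1`, from row `i` on, with bound `c`. -/
def tog (x : ℕ → ℕ → ℤ) (l i : ℕ) (c : ℤ) : ℕ → ℕ → ℤ := fun k r =>
  if k = l + 1 ∧ i ≤ r then
    (if r = i then c else min (x (l + 2) r) (x l (r - 1))) + max (x (l + 2) (r + 1)) (x l r)
      - x (l + 1) r
  else x k r

theorem tog_ne (x : ℕ → ℕ → ℤ) {l k : ℕ} (i : ℕ) (c : ℤ) (h : k ≠ l + 1) (r : ℕ) :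
    tog x l i c k r = x k r := by simp [tog, h]

theorem tog_lt (x : ℕ → ℕ → ℤ) (l k : ℕ) {i r : ℕ} (c : ℤ) (h : r < i) :
    tog x l i c k r = x k r := by
  have : ¬ i ≤ r := by omega
  simp [tog, this]

theorem tog_self (x : ℕ → ℕ → ℤ) (l i : ℕ) (c : ℤ) :
    tog x l i c (l + 1) i = c + max (x (l + 2) (i + 1)) (x l i) - x (l + 1) i := by
  simp [tog]

theorem tog_gt (x : ℕ → ℕ → ℤ) (l : ℕ) {i r : ℕ} (c : ℤ) (h : i ≤ r) :
    tog x l i c (l + 1) (r + 1) = min (x (l + 2) (r + 1)) (x l r)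
      + max (x (l + 2) (r + 2)) (x l (r + 1)) - x (l + 1) (r + 1) := by
  have h1 : i ≤ r + 1 := by omega
  have h2 : r + 1 ≠ i := by omega
  simp [tog, h1, h2]

theorem tog_tog (x : ℕ → ℕ → ℤ) (l i : ℕ) (c : ℤ) : tog (tog x l i c) l i c = x := by
  funext k r
  by_cases hk : k = l + 1
  · subst hk
    rcases lt_trichotomy r i with h | h | h
    · rw [tog_lt _ _ _ _ h, tog_lt _ _ _ _ h]
    · subst h
      rw [tog_self, tog_self, tog_ne _ _ _ (by omega), tog_ne _ _ _ (by omega)]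
      ring
    · obtain ⟨r, rfl⟩ : ∃ r', r = r' + 1 := ⟨r - 1, by omega⟩
      have h' : i ≤ r := by omega
      rw [tog_gt _ _ _ h', tog_gt _ _ _ h', tog_ne _ _ _ (by omega), tog_ne _ _ _ (by omega),
        tog_ne _ _ _ (by omega), tog_ne _ _ _ (by omega)]
      ring
  · rw [tog_ne _ _ _ hk, tog_ne _ _ _ hk]

theorem tog_chain {L : ℕ → ℤ} {M : ℕ} {x : ℕ → ℕ → ℤ} (hx : IsChain L M x) {l i : ℕ} {c : ℤ}
    (hl : l + 2 ≤ M) (h1 : x (l + 1) i ≤ c) (h2 : c ≤ x (l + 2) i)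
    (h3 : ∀ j, i = j + 1 → c ≤ x l j) : IsChain L M (tog x l i c) := by
  have key : ∀ r, x l r ≤ tog x l i c (l + 1) r ∧ x (l + 2) (r + 1) ≤ tog x l i c (l + 1) r
      ∧ tog x l i c (l + 1) r ≤ x (l + 2) r ∧
      (∀ j, r = j + 1 → tog x l i c (l + 1) r ≤ x l j) := by
    intro r
    have u1 := hx.up l r
    have u2 := hx.up (l + 1) r
    have u3 := hx.il (l + 1) r
    rcases lt_trichotomy r i with h | h | h
    · rw [tog_lt _ _ _ _ h]
      refine ⟨u1, u3, u2, ?_⟩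
      rintro j rfl
      exact hx.il l j
    · subst h
      rw [tog_self]
      have u2' : x (l + 1) r ≤ x (l + 2) r := u2
      have u3' : x (l + 2) (r + 1) ≤ x (l + 1) r := u3
      refine ⟨by omega, by omega, by omega, ?_⟩
      intro j hj
      have := h3 j hj
      omega
    · obtain ⟨r, rfl⟩ : ∃ r', r = r' + 1 := ⟨r - 1, by omega⟩
      have h' : i ≤ r := by omega
      rw [tog_gt _ _ _ h']
      have u2' : x (l + 1) (r + 1) ≤ x (l + 2) (r + 1) := u2
      have u3' : x (l + 2) (r + 2) ≤ x (l + 1) (r + 1) := u3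
      have u4 : x (l + 1) (r + 1) ≤ x l r := hx.il l r
      show _ ∧ x (l + 2) (r + 2) ≤ _ ∧ _ ∧ _
      refine ⟨by omega, by omega, by omega, ?_⟩
      intro j hj
      obtain rfl : r = j := by omega
      omega
  refine ⟨?_, ?_, ?_, ?_⟩
  · intro r
    rw [tog_ne _ _ _ (by omega), hx.zero]
  · intro k hk r
    rw [tog_ne _ _ _ (by omega), hx.top k hk]
  · intro k r
    by_cases h : k = l + 1
    · subst h
      rw [tog_ne _ _ _ (show l + 1 + 1 ≠ l + 1 by omega)]
      exact (key r).2.2.1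
    · rw [tog_ne _ _ _ h]
      by_cases h' : k = l
      · subst h'; exact (key r).1
      · rw [tog_ne _ _ _ (by omega)]; exact hx.up k r
  · intro k r
    by_cases h : k = l + 1
    · subst h
      rw [tog_ne _ _ _ (show l + 1 + 1 ≠ l + 1 by omega)]
      exact (key r).2.1
    · rw [tog_ne _ _ _ h]
      by_cases h' : k = l
      · subst h'; exact (key (r + 1)).2.2.2 r rfl
      · rw [tog_ne _ _ _ (by omega)]; exact hx.il k r

theorem psum_tog_ne (x : ℕ → ℕ → ℤ) {l k : ℕ} (i : ℕ) (c : ℤ) (h : k ≠ l + 1) (m : ℕ) :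
    psum (tog x l i c) k m = psum x k m := by
  unfold psum
  exact Finset.sum_congr rfl fun r _ => tog_ne _ _ _ h r

theorem psum_tog_le (x : ℕ → ℕ → ℤ) (l k : ℕ) {i m : ℕ} (c : ℤ) (h : m ≤ i) :
    psum (tog x l i c) k m = psum x k m := by
  unfold psum
  refine Finset.sum_congr rfl fun r hr => tog_lt _ _ _ _ ?_
  have := Finset.mem_range.1 hr
  omega

theorem psum_tog_aux (x : ℕ → ℕ → ℤ) (l i : ℕ) (c : ℤ) (d : ℕ) :
    psum (tog x l i c) (l + 1) (i + d + 1) = 2 * psum x (l + 1) i + c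
      + psum x (l + 2) (i + d + 1) - psum x (l + 2) (i + 1) + psum x l (i + d) - psum x l i
      + max (x (l + 2) (i + d + 1)) (x l (i + d)) - psum x (l + 1) (i + d + 1) := by
  induction d with
  | zero =>
    have e := psum_succ (tog x l i c) (l + 1) i
    rw [psum_tog_le _ _ _ _ le_rfl, tog_self] at e
    have e2 := psum_succ x (l + 1) i
    simp only [Nat.add_zero]
    linarith
  | succ d ih =>
    have e := psum_succ (tog x l i c) (l + 1) (i + d + 1)
    rw [tog_gt _ _ _ (by omega)] at e
    have e2 := psum_succ x (l + 1) (i + d + 1)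
    have e3 := psum_succ x (l + 2) (i + d + 1)
    have e4 := psum_succ x l (i + d)
    have e5 := min_add_max (x (l + 2) (i + d + 1)) (x l (i + d))
    have e6 : i + (d + 1) = i + d + 1 := by omega
    rw [e6]
    have e7 : i + d + 1 + 1 = i + d + 2 := by omega
    simp only [e7] at *
    linarith

theorem IsChain.nonneg {L : ℕ → ℤ} {M : ℕ} {x : ℕ → ℕ → ℤ} (hx : IsChain L M x) (k r : ℕ) :
    0 ≤ x k r := by
  induction k with
  | zero => rw [hx.zero]
  | succ k ih => exact ih.trans (hx.up k r)

theorem IsChain.mono {L : ℕ → ℤ} {M : ℕ} {x : ℕ → ℕ → ℤ} (hx : IsChain L M x) (r : ℕ) :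
    Monotone (fun k => x k r) := monotone_nat_of_le_succ fun k => hx.up k r

theorem IsChain.le {L : ℕ → ℤ} {M : ℕ} {x : ℕ → ℕ → ℤ} (hx : IsChain L M x) (k r : ℕ) :
    x k r ≤ L r := by
  rw [← hx.top (max k M) (le_max_right _ _) r]
  exact hx.mono r (le_max_left _ _)

theorem IsChain.eq_zero {L : ℕ → ℤ} {M : ℕ} {x : ℕ → ℕ → ℤ} (hx : IsChain L M x) {N : ℕ}
    (hN : ∀ r, N ≤ r → L r = 0) (k : ℕ) {r : ℕ} (hr : N ≤ r) : x k r = 0 := by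
  have := hx.nonneg k r
  have := hx.le k r
  have := hN r hr
  omega

theorem psum_tog {L : ℕ → ℤ} {M : ℕ} {x : ℕ → ℕ → ℤ} (hx : IsChain L M x) {N : ℕ}
    (hN : ∀ r, N ≤ r → L r = 0) (l : ℕ) {i : ℕ} (c : ℤ) (hi : i < N) :
    psum (tog x l i c) (l + 1) N = 2 * psum x (l + 1) i + c
      + psum x (l + 2) N - psum x (l + 2) (i + 1) + psum x l N - psum x l i
      - psum x (l + 1) N := by
  obtain ⟨d, rfl⟩ : ∃ d, N = i + d + 1 := ⟨N - i - 1, by omega⟩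
  rw [psum_tog_aux, psum_succ x l (i + d), hx.eq_zero hN (l + 2) le_rfl,
    max_eq_right (hx.nonneg _ _)]
  ring

/-- Number of entries equal to letter `k`. -/
def wt (N : ℕ) (x : ℕ → ℕ → ℤ) (k : ℕ) : ℤ := psum x (k + 1) N - psum x k N

/-- Violation of the lattice condition by letters `l`, `l+1` in row `i`. -/
def Viol (x : ℕ → ℕ → ℤ) (l i : ℕ) : Prop :=
  psum x (l + 1) i - psum x l i < psum x (l + 2) (i + 1) - psum x (l + 1) (i + 1)

def Latt (s n : ℕ) (x : ℕ → ℕ → ℤ) : Prop :=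
  ∀ l, s ≤ l → l + 2 ≤ s + n → ∀ i, ¬ Viol x l i

theorem finite_chain (L : ℕ → ℤ) (M N : ℕ) (hN : ∀ r, N ≤ r → L r = 0) :
    {x | IsChain L M x}.Finite := by
  refine Set.Finite.of_injOn (f := fun x => fun p : Fin M × Fin N => x p.1 p.2)
    (t := Set.Icc 0 (fun p => L p.2)) ?_ ?_ (Set.finite_Icc _ _)
  · intro x hx
    exact ⟨fun p => hx.nonneg _ _, fun p => hx.le _ _⟩
  · intro x hx y hy h
    funext k r
    by_cases hk : M ≤ k
    · rw [hx.top k hk, hy.top k hk]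
    · by_cases hr : N ≤ r
      · rw [hx.eq_zero hN k hr, hy.eq_zero hN k hr]
      · exact congrFun h (⟨k, by omega⟩, ⟨r, by omega⟩)

/-- Signed indicator. -/
def sgnInd (n : ℕ) (v w : ℕ → ℤ) : ℤ :=
  Matrix.det (Matrix.of fun i j : Fin n => if w i - (i : ℕ) = v j - (j : ℕ) then (1 : ℤ) else 0)

theorem sgnInd_congr {n : ℕ} {v w w' : ℕ → ℤ} (h : ∀ i < n, w i = w' i) :
    sgnInd n v w = sgnInd n v w' := by
  unfold sgnInd
  congr 2
  funext i j
  rw [h i i.2]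

theorem sgnInd_swap {n : ℕ} {v w w' : ℕ → ℤ} {t : ℕ} (ht : t + 1 < n)
    (h1 : w' t = w (t + 1) - 1) (h2 : w' (t + 1) = w t + 1)
    (h : ∀ i, i ≠ t → i ≠ t + 1 → w' i = w i) : sgnInd n v w' = - sgnInd n v w := by
  unfold sgnInd
  have hne : (⟨t, by omega⟩ : Fin n) ≠ ⟨t + 1, ht⟩ := by simp
  have := Matrix.det_permute (Equiv.swap (⟨t, by omega⟩ : Fin n) ⟨t + 1, ht⟩)
    (Matrix.of fun i j : Fin n => if w i - (i : ℕ) = v j - (j : ℕ) then (1 : ℤ) else 0)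
  rw [Equiv.Perm.sign_swap hne] at this
  simp only [Units.val_neg, Units.val_one, Int.cast_neg, Int.cast_one, neg_mul, one_mul] at this
  rw [← this]
  congr 1
  ext i j
  simp only [Matrix.of_apply, Matrix.submatrix_apply, id]
  by_cases hi : i = ⟨t, by omega⟩
  · subst hi
    rw [Equiv.swap_apply_left]
    simp only [h1]
    congr 1
    push_cast
    apply propext
    constructor <;> intro h <;> linarith
  · by_cases hi' : i = ⟨t + 1, ht⟩
    · subst hi'
      rw [Equiv.swap_apply_right]
      simp only [h2]
      congr 1
      push_cast
      apply propext
      constructor <;> intro h <;> linarith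
    · rw [Equiv.swap_apply_of_ne_of_ne hi hi', h]
      · intro e; exact hi (Fin.ext e)
      · intro e; exact hi' (Fin.ext e)

theorem sgnInd_dom {n : ℕ} {v w : ℕ → ℤ} (hv : Antitone v)
    (hw : ∀ i, i + 1 < n → w (i + 1) ≤ w i) :
    sgnInd n v w = if ∀ i < n, w i = v i then 1 else 0 := by
  have hw' : ∀ i j, i < j → j < n → w j ≤ w i := by
    intro i j hij hj
    induction j, hij using Nat.le_induction with
    | base => exact hw i hj
    | succ j hij ih => exact (hw j hj).trans (ih (by omega))
  split_ifs with h
  · unfold sgnInd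
    refine Eq.trans (congrArg Matrix.det ?_) (Matrix.det_one (n := Fin n) (R := ℤ))
    ext i j
    simp only [Matrix.of_apply, Matrix.one_apply]
    congr 1
    apply propext
    rw [h i i.2]
    constructor
    · intro e
      rcases lt_trichotomy (i : ℕ) j with hij | hij | hij
      · have := hv hij.le
        omega
      · exact Fin.ext hij
      · have := hv hij.le
        omega
    · rintro rfl; rfl
  · by_contra hne
    unfold sgnInd at hne
    rw [Matrix.det_apply] at hne
    obtain ⟨σ, -, hσ⟩ := Finset.exists_ne_zero_of_sum_ne_zero hne
    have hp : ∀ i : Fin n, w (σ i) - (σ i : ℕ) = v i - (i : ℕ) := by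
      intro i
      by_contra hc
      apply hσ
      rw [Finset.prod_eq_zero (Finset.mem_univ i), smul_zero]
      simp [hc]
    have hm : StrictMono σ := by
      intro i j hij
      by_contra hc
      have h1 := hp i
      have h2 := hp j
      have hij' : (i : ℕ) < j := hij
      have h3 : σ i ≠ σ j := fun e => hij.ne (σ.injective e)
      have h4 : (σ j : ℕ) < σ i := lt_of_le_of_ne (not_lt.1 hc) (fun e => h3 (Fin.ext e.symm))
      have h5 := hw' _ _ h4 (σ i).2
      have h6 := hv hij'.le
      omega
    have hid : ∀ i, σ i = i := by
      intro i
      have : (hm.orderIsoOfSurjective σ σ.surjective) = OrderIso.refl _ := Subsingleton.elim _ _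
      exact congrArg (fun f : Fin n ≃o Fin n => f i) this
    apply h
    intro i hi
    have := hp ⟨i, hi⟩
    rw [hid] at this
    simpa using this

/-! ### The sign-reversing involution -/

theorem viol_bounds {L : ℕ → ℤ} {M : ℕ} {x : ℕ → ℕ → ℤ} (hx : IsChain L M x) {l i : ℕ}
    (hv : Viol x l i) (hmin : ∀ j < i, ¬ Viol x l j) :
    x (l + 1) i ≤ psum x (l + 2) (i + 1) + psum x l i - 2 * psum x (l + 1) i - 1 ∧
    psum x (l + 2) (i + 1) + psum x l i - 2 * psum x (l + 1) i - 1 ≤ x (l + 2) i - 1 ∧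
    ∀ j, i = j + 1 → psum x (l + 2) (i + 1) + psum x l i - 2 * psum x (l + 1) i - 1 ≤ x l j := by
  unfold Viol at hv hmin
  have e1 := psum_succ x (l + 1) i
  have e2 := psum_succ x (l + 2) i
  rcases i with _ | j
  · simp only [psum_zero] at *
    refine ⟨by omega, by omega, ?_⟩
    intro j hj; omega
  · have hm := hmin j (by omega)
    have e3 := psum_succ x (l + 1) j
    have e4 := psum_succ x (l + 2) j
    have e5 := psum_succ x l j
    have u1 := hx.up l j
    have u2 : x (l + 2) (j + 1) ≤ x (l + 1) j := hx.il (l + 1) j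
    refine ⟨by omega, by omega, ?_⟩
    intro j' hj
    obtain rfl : j = j' := by omega
    omega

/-- The place where the involution acts. -/
def IsPick (s n : ℕ) (x : ℕ → ℕ → ℤ) (p : ℕ × ℕ) : Prop :=
  s ≤ p.1 ∧ p.1 + 2 ≤ s + n ∧ Viol x p.1 p.2 ∧
  (∀ l, s ≤ l → l + 2 ≤ s + n → ∀ j < p.2, ¬ Viol x l j) ∧
  (∀ l, p.1 < l → l + 2 ≤ s + n → ¬ Viol x l p.2)

theorem exists_pick {s n : ℕ} {x : ℕ → ℕ → ℤ} (h : ¬ Latt s n x) : ∃ p, IsPick s n x p := by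
  have h' : ∃ i, ∃ l, s ≤ l ∧ l + 2 ≤ s + n ∧ Viol x l i := by
    unfold Latt at h
    push Not at h
    obtain ⟨l, h1, h2, i, h3⟩ := h
    exact ⟨i, l, h1, h2, h3⟩
  have hs := Nat.find_spec h'
  have hm : ∀ j < Nat.find h', _ := fun j hj => Nat.find_min h' hj
  generalize Nat.find h' = i at hs hm
  obtain ⟨l, h1, h2, h3⟩ := hs
  have hb : ∀ l, (s ≤ l ∧ l + 2 ≤ s + n ∧ Viol x l i) → l ≤ s + n := fun l h => by omega
  have hg := Nat.findGreatest_spec (P := fun l => s ≤ l ∧ l + 2 ≤ s + n ∧ Viol x l i)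
    (hb l ⟨h1, h2, h3⟩) ⟨h1, h2, h3⟩
  have hgm : ∀ k, Nat.findGreatest (fun l => s ≤ l ∧ l + 2 ≤ s + n ∧ Viol x l i) (s + n) < k →
      k ≤ s + n → _ := fun k hk hk' => Nat.findGreatest_is_greatest hk hk'
  generalize Nat.findGreatest (fun l => s ≤ l ∧ l + 2 ≤ s + n ∧ Viol x l i) (s + n) = g at hg hgm
  refine ⟨(g, i), hg.1, hg.2.1, hg.2.2, ?_, ?_⟩
  · intro l a b j hj hv
    exact hm j hj ⟨l, a, b, hv⟩
  · intro l a b hv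
    exact hgm l a (by omega) ⟨by have := hg.1; omega, b, hv⟩

theorem pick_unique {s n : ℕ} {x : ℕ → ℕ → ℤ} {p q : ℕ × ℕ} (hp : IsPick s n x p)
    (hq : IsPick s n x q) : p = q := by
  obtain ⟨l, i⟩ := p
  obtain ⟨l', i'⟩ := q
  obtain ⟨p1, p2, p3, p4, p5⟩ := hp
  obtain ⟨q1, q2, q3, q4, q5⟩ := hq
  simp only at *
  have hi : i = i' := by
    rcases lt_trichotomy i i' with h | h | h
    · exact absurd p3 (q4 l p1 p2 i h)
    · exact h
    · exact absurd q3 (p4 l' q1 q2 i' h)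
  subst hi
  have hl : l = l' := by
    rcases lt_trichotomy l l' with h | h | h
    · exact absurd q3 (p5 l' h q2)
    · exact h
    · exact absurd p3 (q5 l h p2)
  rw [hl]

/-- The bound used for the toggle. -/
def bd (x : ℕ → ℕ → ℤ) (p : ℕ × ℕ) : ℤ :=
  psum x (p.1 + 2) (p.2 + 1) + psum x p.1 p.2 - 2 * psum x (p.1 + 1) p.2 - 1

/-- The sign-reversing involution at a given place. -/
def flipAt (x : ℕ → ℕ → ℤ) (p : ℕ × ℕ) : ℕ → ℕ → ℤ := tog x p.1 p.2 (bd x p)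

theorem bd_flipAt' (x : ℕ → ℕ → ℤ) (p : ℕ × ℕ) (c : ℤ) :
    bd (tog x p.1 p.2 c) p = bd x p := by
  simp only [bd]
  rw [psum_tog_ne _ _ _ (by omega), psum_tog_ne _ _ _ (by omega), psum_tog_le _ _ _ _ le_rfl]

theorem flipAt_flipAt (x : ℕ → ℕ → ℤ) (p : ℕ × ℕ) : flipAt (flipAt x p) p = x := by
  have h := bd_flipAt' x p (bd x p)
  show tog (tog x p.1 p.2 (bd x p)) p.1 p.2 (bd (tog x p.1 p.2 (bd x p)) p) = x
  rw [h, tog_tog]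

theorem flipAt_chain {L : ℕ → ℤ} {M s n : ℕ} (hs : s + n ≤ M) {x : ℕ → ℕ → ℤ}
    (hx : IsChain L M x) {p : ℕ × ℕ} (hp : IsPick s n x p) : IsChain L M (flipAt x p) := by
  obtain ⟨p1, p2, p3, p4, p5⟩ := hp
  obtain ⟨h1, h2, h3⟩ := viol_bounds hx p3 (fun j hj => p4 p.1 p1 p2 j hj)
  exact tog_chain hx (by omega) h1 (by unfold bd; omega) h3

theorem pick_flipAt {L : ℕ → ℤ} {M s n : ℕ} {x : ℕ → ℕ → ℤ}
    (hx : IsChain L M x) {p : ℕ × ℕ} (hp : IsPick s n x p) : IsPick s n (flipAt x p) p := by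
  obtain ⟨p1, p2, p3, p4, p5⟩ := hp
  have hb := viol_bounds hx p3 (fun j hj => p4 p.1 p1 p2 j hj)
  refine ⟨p1, p2, ?_, ?_, ?_⟩
  · have hd : bd x p = psum x (p.1 + 2) (p.2 + 1) + psum x p.1 p.2
      - 2 * psum x (p.1 + 1) p.2 - 1 := rfl
    unfold flipAt Viol
    rw [psum_tog_le x p.1 (p.1 + 1) _ le_rfl, psum_tog_le x p.1 p.1 _ le_rfl,
      psum_tog_ne x p.2 _ (show p.1 + 2 ≠ p.1 + 1 by omega), psum_succ _ (p.1 + 1),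
      psum_tog_le _ _ _ _ le_rfl, tog_self]
    have u1 := hx.up p.1 p.2
    have u2 : x (p.1 + 2) (p.2 + 1) ≤ x (p.1 + 1) p.2 := hx.il (p.1 + 1) p.2
    omega
  · intro l a b j hj
    have := p4 l a b j hj
    unfold flipAt Viol
    rw [psum_tog_le _ _ _ _ (by omega), psum_tog_le _ _ _ _ (by omega),
      psum_tog_le _ _ _ _ (by omega), psum_tog_le _ _ _ _ (by omega)]
    exact this
  · intro l a b
    have := p5 l a b
    unfold flipAt Viol
    rw [psum_tog_le x p.1 (l + 1) _ le_rfl, psum_tog_le x p.1 l _ le_rfl,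
      psum_tog_ne x p.2 _ (show l + 2 ≠ p.1 + 1 by omega),
      psum_tog_ne x p.2 _ (show l + 1 ≠ p.1 + 1 by omega)]
    exact this

theorem wt_tog_ne (N : ℕ) (x : ℕ → ℕ → ℤ) {l k : ℕ} (i : ℕ) (c : ℤ) (h : k ≠ l)
    (h' : k ≠ l + 1) : wt N (tog x l i c) k = wt N x k := by
  unfold wt
  rw [psum_tog_ne _ _ _ (by omega), psum_tog_ne _ _ _ (by omega)]

theorem wt_flipAt {L : ℕ → ℤ} {M N s n : ℕ} (hN : ∀ r, N ≤ r → L r = 0) {x : ℕ → ℕ → ℤ}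
    (hx : IsChain L M x) {p : ℕ × ℕ} (hp : IsPick s n x p) :
    wt N (flipAt x p) p.1 = wt N x (p.1 + 1) - 1 ∧
    wt N (flipAt x p) (p.1 + 1) = wt N x p.1 + 1 := by
  obtain ⟨p1, p2, p3, p4, p5⟩ := hp
  obtain ⟨h1, h2, h3⟩ := viol_bounds hx p3 (fun j hj => p4 p.1 p1 p2 j hj)
  have hi : p.2 < N := by
    by_contra hc
    have := hx.eq_zero hN (p.1 + 2) (not_lt.1 hc)
    have := hx.nonneg (p.1 + 1) p.2
    omega
  have e := psum_tog hx hN p.1 (bd x p) hi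
  have hd : bd x p = psum x (p.1 + 2) (p.2 + 1) + psum x p.1 p.2
      - 2 * psum x (p.1 + 1) p.2 - 1 := rfl
  unfold wt flipAt
  rw [psum_tog_ne x p.2 _ (show p.1 ≠ p.1 + 1 by omega),
    psum_tog_ne x p.2 _ (show p.1 + 1 + 1 ≠ p.1 + 1 by omega)]
  constructor
  · rw [e]; show _ = psum x (p.1 + 2) N - _ - 1; omega
  · rw [e]; show psum x (p.1 + 2) N - _ = _; omega

theorem window_sum {L : ℕ → ℤ} {M N s n : ℕ} (hN : ∀ r, N ≤ r → L r = 0) (hs : s + n ≤ M)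
    (C : Finset (ℕ → ℕ → ℤ)) (hC : ∀ x, x ∈ C ↔ IsChain L M x) (v : ℕ → ℤ)
    (G : (ℕ → ℕ → ℤ) → ℤ)
    (hG : ∀ x l i c, s ≤ l → l + 2 ≤ s + n → G (tog x l i c) = G x) :
    ∑ x ∈ C, sgnInd n v (fun k => wt N x (s + k)) * G x =
    ∑ x ∈ C.filter (Latt s n), sgnInd n v (fun k => wt N x (s + k)) * G x := by
  rw [← Finset.sum_filter_add_sum_filter_not C (Latt s n)]
  rw [add_eq_left]
  have hch : ∀ x, ∃ p, ¬ Latt s n x → IsPick s n x p := by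
    intro x
    by_cases h : Latt s n x
    · exact ⟨(0, 0), fun h' => absurd h h'⟩
    · obtain ⟨p, hp⟩ := exists_pick h
      exact ⟨p, fun _ => hp⟩
  choose P hP using hch
  have hnl : ∀ x p, IsPick s n x p → ¬ Latt s n x := by
    intro x p hp hl
    exact hl p.1 hp.1 hp.2.1 p.2 hp.2.2.1
  have hsign : ∀ x, IsChain L M x → ¬ Latt s n x →
      sgnInd n v (fun k => wt N (flipAt x (P x)) (s + k)) * G (flipAt x (P x)) =
      - (sgnInd n v (fun k => wt N x (s + k)) * G x) := by
    intro x hx hl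
    have hp := hP x hl
    rw [show G (flipAt x (P x)) = G x from hG _ _ _ _ hp.1 hp.2.1]
    obtain ⟨w1, w2⟩ := wt_flipAt hN hx hp
    obtain ⟨t, ht⟩ : ∃ t, (P x).1 = s + t := ⟨(P x).1 - s, by have := hp.1; omega⟩
    rw [sgnInd_swap (t := t) (v := v) (w := fun k => wt N x (s + k))
      (w' := fun k => wt N (flipAt x (P x)) (s + k)), neg_mul]
    · have := hp.2.1; omega
    · simp only [← Nat.add_assoc, ← ht]; exact w1
    · simp only [← Nat.add_assoc, ← ht]; exact w2
    · intro i h1 h2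
      exact wt_tog_ne _ _ _ _ (by omega) (by omega)
  refine Finset.sum_involution (fun x _ => flipAt x (P x)) ?_ ?_ ?_ ?_
  · intro x hx
    rw [Finset.mem_filter, hC] at hx
    rw [hsign x hx.1 hx.2]
    ring
  · intro x hx hne heq
    rw [Finset.mem_filter, hC] at hx
    have := hsign x hx.1 hx.2
    rw [heq] at this
    omega
  · intro x hx
    rw [Finset.mem_filter, hC] at hx ⊢
    exact ⟨flipAt_chain hs hx.1 (hP x hx.2), hnl _ _ (pick_flipAt hx.1 (hP x hx.2))⟩
  · intro x hx
    rw [Finset.mem_filter, hC] at hx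
    have h1 := pick_flipAt hx.1 (hP x hx.2)
    have h2 := pick_unique (hP _ (hnl _ _ h1)) h1
    simp only [h2]
    exact flipAt_flipAt _ _

/-! ### Symmetry (Bender-Knuth) -/

theorem bk_adj {L : ℕ → ℤ} {M N : ℕ} (hN : ∀ r, N ≤ r → L r = 0) (hN0 : 0 < N)
    (C : Finset (ℕ → ℕ → ℤ)) (hC : ∀ x, x ∈ C ↔ IsChain L M x) (F : (ℕ → ℤ) → ℤ)
    (l : ℕ) (hl : l + 2 ≤ M) :
    ∑ x ∈ C, F (wt N x) = ∑ x ∈ C, F (wt N x ∘ Equiv.swap l (l + 1)) := by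
  refine Finset.sum_bij' (fun x _ => tog x l 0 (x (l + 2) 0)) (fun x _ => tog x l 0 (x (l + 2) 0))
    ?_ ?_ ?_ ?_ ?_
  · intro x hx
    rw [hC] at hx ⊢
    exact tog_chain hx hl (hx.up (l + 1) 0) le_rfl (by intro j hj; omega)
  · intro x hx
    rw [hC] at hx ⊢
    exact tog_chain hx hl (hx.up (l + 1) 0) le_rfl (by intro j hj; omega)
  · intro x hx
    rw [tog_ne _ _ _ (by omega), tog_tog]
  · intro x hx
    rw [tog_ne _ _ _ (by omega), tog_tog]
  · intro x hx
    rw [hC] at hx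
    congr 1
    have e := psum_tog hx hN l (x (l + 2) 0) hN0
    rw [psum_succ, psum_zero, psum_zero, psum_zero] at e
    funext k
    simp only [Function.comp]
    by_cases h1 : k = l
    · subst h1
      rw [Equiv.swap_apply_left]
      unfold wt
      rw [psum_tog_ne x 0 _ (show k + 1 + 1 ≠ k + 1 by omega), e]
      show _ = psum x (k + 2) N - _
      omega
    · by_cases h2 : k = l + 1
      · subst h2
        rw [Equiv.swap_apply_right]
        unfold wt
        rw [psum_tog_ne x 0 _ (show l ≠ l + 1 by omega), e]
        show psum x (l + 2) N - _ = _
        omega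
      · rw [Equiv.swap_apply_of_ne_of_ne h1 h2, wt_tog_ne _ _ _ _ h1 h2]

theorem bk_swap {L : ℕ → ℤ} {M N : ℕ} (hN : ∀ r, N ≤ r → L r = 0) (hN0 : 0 < N)
    (C : Finset (ℕ → ℕ → ℤ)) (hC : ∀ x, x ∈ C ↔ IsChain L M x) (a d : ℕ) (hl : a + d < M) :
    ∀ F : (ℕ → ℤ) → ℤ,
    ∑ x ∈ C, F (wt N x) = ∑ x ∈ C, F (wt N x ∘ Equiv.swap a (a + d)) := by
  induction d with
  | zero => intro F; simp
  | succ d ih =>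
    intro F
    rcases Nat.eq_zero_or_pos d with rfl | hd
    · exact bk_adj hN hN0 C hC F a (by omega)
    · have e : Equiv.swap a (a + (d + 1)) = Equiv.swap (a + d) (a + d + 1) * Equiv.swap a (a + d)
          * Equiv.swap (a + d) (a + d + 1) := by
        rw [Equiv.swap_mul_swap_mul_swap (by omega) (by omega), Equiv.swap_comm]
        congr 1
      rw [bk_adj hN hN0 C hC F (a + d) (by omega),
        ih (by omega) (fun w => F (w ∘ Equiv.swap (a + d) (a + d + 1))),
        bk_adj hN hN0 C hC (fun w => F ((w ∘ Equiv.swap a (a + d)) ∘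
          Equiv.swap (a + d) (a + d + 1))) (a + d) (by omega), e]
      rfl

/-- Swap the first `m` letters of two blocks of length `n`. -/
def blk (n m i : ℕ) : ℕ :=
  if i < m then i + n else if n ≤ i ∧ i < n + m then i - n else i

theorem bk_blk {L : ℕ → ℤ} {M N : ℕ} (hN : ∀ r, N ≤ r → L r = 0) (hN0 : 0 < N)
    (C : Finset (ℕ → ℕ → ℤ)) (hC : ∀ x, x ∈ C ↔ IsChain L M x) (n : ℕ) (hn : n + n ≤ M)
    (m : ℕ) (hm : m ≤ n) : ∀ F : (ℕ → ℤ) → ℤ,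
    ∑ x ∈ C, F (wt N x) = ∑ x ∈ C, F (wt N x ∘ blk n m) := by
  induction m with
  | zero =>
    intro F
    have : blk n 0 = id := by
      funext i
      simp only [blk, id]
      split_ifs <;> omega
    simp [this]
  | succ m ih =>
    intro F
    rw [ih (by omega) F, bk_swap hN hN0 C hC m n (by omega) (fun w => F (w ∘ blk n m))]
    refine Finset.sum_congr rfl fun x _ => ?_
    congr 1
    funext i
    simp only [Function.comp]
    congr 1
    unfold blk
    rw [Equiv.swap_apply_def]
    split_ifs <;> omega

/-! ### Counting pairs of lattice chains -/

/-- Both halves of the chain satisfy the lattice condition and have prescribed content. -/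
def Good (n : ℕ) (u v : ℕ → ℤ) (x : ℕ → ℕ → ℤ) : Prop :=
  Latt 0 n x ∧ Latt n n x ∧ (∀ i < n, wt n x i = u i) ∧ (∀ i < n, wt n x (n + i) = v i)

theorem latt_wt {L : ℕ → ℤ} {M N s n : ℕ} (hN : ∀ r, N ≤ r → L r = 0) {x : ℕ → ℕ → ℤ}
    (hx : IsChain L M x) (hl : Latt s n x) (i : ℕ) (hi : i + 1 < n) :
    wt N x (s + (i + 1)) ≤ wt N x (s + i) := by
  have h := hl (s + i) (by omega) (by omega) N
  unfold Viol at h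
  rw [psum_succ, psum_succ, hx.eq_zero hN _ le_rfl, hx.eq_zero hN _ le_rfl] at h
  unfold wt
  rw [show s + (i + 1) + 1 = s + i + 2 by omega, show s + (i + 1) = s + i + 1 by omega]
  omega

theorem signed_sum {L : ℕ → ℤ} {n : ℕ} (hN : ∀ r, n ≤ r → L r = 0)
    (C : Finset (ℕ → ℕ → ℤ)) (hC : ∀ x, x ∈ C ↔ IsChain L (n + n) x) (u v : ℕ → ℤ)
    (hu : Antitone u) (hv : Antitone v) :
    ∑ x ∈ C, sgnInd n u (fun k => wt n x (0 + k)) * sgnInd n v (fun k => wt n x (n + k)) =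
      ((C.filter (Good n u v)).card : ℤ) := by
  rw [window_sum hN (by omega) C hC u (fun x => sgnInd n v (fun k => wt n x (n + k)))]
  · rw [Finset.sum_filter]
    have h2 := window_sum (s := n) (n := n) hN le_rfl C hC v
      (fun x => if Latt 0 n x then sgnInd n u (fun k => wt n x (0 + k)) else 0) ?_
    · calc _ = _ := Finset.sum_congr rfl fun x _ => ?_
        _ = _ := h2
        _ = _ := ?_
      · split_ifs
        · ring
        · ring
      · rw [Finset.sum_filter, Finset.card_filter]
        push_cast
        refine Finset.sum_congr rfl fun x hx => ?_
        rw [hC] at hx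
        by_cases h0 : Latt 0 n x
        · by_cases h1 : Latt n n x
          · rw [if_pos h1, if_pos h0, sgnInd_dom hu (latt_wt hN hx h0),
              sgnInd_dom hv (latt_wt hN hx h1)]
            simp only [Good, h0, h1, true_and, Nat.zero_add]
            split_ifs <;> first | (exfalso; tauto) | norm_num
          · simp [Good, h1]
        · simp [Good, h0]
    · intro x l i c h1 h2
      have e1 : Latt 0 n (tog x l i c) ↔ Latt 0 n x := by
        unfold Latt
        refine forall_congr' fun l' => forall_congr' fun a => forall_congr' fun b =>
          forall_congr' fun j => ?_
        unfold Viol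
        rw [psum_tog_ne x i c (show l' + 1 ≠ l + 1 by omega),
          psum_tog_ne x i c (show l' ≠ l + 1 by omega),
          psum_tog_ne x i c (show l' + 2 ≠ l + 1 by omega),
          psum_tog_ne x i c (show l' + 1 ≠ l + 1 by omega)]
      have e2 : sgnInd n u (fun k => wt n (tog x l i c) (0 + k)) =
          sgnInd n u (fun k => wt n x (0 + k)) :=
        sgnInd_congr fun k hk => wt_tog_ne _ _ _ _ (by omega) (by omega)
      simp only [e1, e2]
  · intro x l i c h1 h2
    exact sgnInd_congr fun k hk => wt_tog_ne _ _ _ _ (by omega) (by omega)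

theorem good_card_symm {L : ℕ → ℤ} {n : ℕ} (hn : 0 < n) (hN : ∀ r, n ≤ r → L r = 0)
    (C : Finset (ℕ → ℕ → ℤ)) (hC : ∀ x, x ∈ C ↔ IsChain L (n + n) x) (u v : ℕ → ℤ)
    (hu : Antitone u) (hv : Antitone v) :
    (C.filter (Good n u v)).card = (C.filter (Good n v u)).card := by
  have h1 := signed_sum hN C hC u v hu hv
  have h2 := signed_sum hN C hC v u hv hu
  have h3 := bk_blk hN hn C hC n le_rfl n le_rfl
    (fun w => sgnInd n u (fun k => w (0 + k)) * sgnInd n v (fun k => w (n + k)))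
  have h4 : ∑ x ∈ C, sgnInd n u (fun k => wt n x (0 + k)) * sgnInd n v (fun k => wt n x (n + k))
      = ∑ x ∈ C, sgnInd n v (fun k => wt n x (0 + k)) * sgnInd n u (fun k => wt n x (n + k)) := by
    refine h3.trans (Finset.sum_congr rfl fun x _ => ?_)
    rw [mul_comm]
    congr 1
    · refine sgnInd_congr fun k hk => ?_
      simp only [Function.comp]
      congr 1
      unfold blk
      split_ifs <;> omega
    · refine sgnInd_congr fun k hk => ?_
      simp only [Function.comp]
      congr 1
      unfold blk
      split_ifs <;> omega
  rw [h1, h2] at h4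
  exact_mod_cast h4

theorem IsChain.zero_of_le {L : ℕ → ℤ} {M : ℕ} {x : ℕ → ℕ → ℤ} (hx : IsChain L M x) (k : ℕ) :
    ∀ r, k ≤ r → x k r = 0 := by
  induction k with
  | zero => intro r _; exact hx.zero r
  | succ k ih =>
    intro r hr
    obtain ⟨r, rfl⟩ : ∃ r', r = r' + 1 := ⟨r - 1, by omega⟩
    have h1 := ih r (by omega)
    have h2 := hx.il k r
    have h3 := hx.nonneg (k + 1) (r + 1)
    omega

theorem psum_up {L : ℕ → ℤ} {M : ℕ} {x : ℕ → ℕ → ℤ} (hx : IsChain L M x) (k m : ℕ) :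
    psum x k m ≤ psum x (k + 1) m := Finset.sum_le_sum fun r _ => hx.up k r

theorem psum_const (x : ℕ → ℕ → ℤ) (k m d : ℕ) (h : ∀ r, m ≤ r → x k r = 0) :
    psum x k (m + d) = psum x k m := by
  induction d with
  | zero => rfl
  | succ d ih => rw [← Nat.add_assoc, psum_succ, ih, h _ (by omega), add_zero]

theorem forced {L : ℕ → ℤ} {M n : ℕ} {x : ℕ → ℕ → ℤ} (hx : IsChain L M x) (hl : Latt 0 n x)
    {u : ℕ → ℤ} (hu : ∀ i < n, wt n x i = u i) :
    ∀ k, k ≤ n → ∀ r, x k r = if r < k then u r else 0 := by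
  have Q : ∀ j, j < n → ∀ i, i ≤ j → psum x (j + 1) i = psum x j i := by
    intro j
    induction j with
    | zero =>
      intro _ i hi
      obtain rfl : i = 0 := by omega
      rw [psum_zero, psum_zero]
    | succ j ih =>
      intro hj i hi
      rcases i with _ | i
      · rw [psum_zero, psum_zero]
      · have h1 := ih (by omega) i (by omega)
        have h2 := hl j (by omega) (by omega) i
        unfold Viol at h2
        have h3 : psum x (j + 1) (i + 1) ≤ psum x (j + 2) (i + 1) := psum_up hx (j + 1) (i + 1)
        show psum x (j + 2) (i + 1) = _
        omega
  intro k
  induction k with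
  | zero => intro _ r; simp [hx.zero]
  | succ k ih =>
    intro hk r
    rcases lt_trichotomy r k with h | h | h
    · have h1 := Q k (by omega) r (by omega)
      have h2 := Q k (by omega) (r + 1) (by omega)
      rw [psum_succ, psum_succ] at h2
      have h3 := ih (by omega) r
      rw [if_pos h] at h3
      rw [if_pos (by omega), ← h3]
      omega
    · subst h
      rw [if_pos (by omega), ← hu r (by omega)]
      have e1 := psum_const x (r + 1) (r + 1) (n - (r + 1)) (hx.zero_of_le (r + 1))
      have e2 := psum_const x r r (n - r) (hx.zero_of_le r)
      rw [show r + 1 + (n - (r + 1)) = n by omega] at e1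
      rw [show r + (n - r) = n by omega] at e2
      unfold wt
      rw [e1, e2, psum_succ, Q r (by omega) r le_rfl]
      ring
    · rw [if_neg (by omega), hx.zero_of_le (k + 1) r (by omega)]

/-! ### Tableaux and chains -/

/-- Row length as an integer function. -/
def rl (m : YoungDiagram) : ℕ → ℤ := fun r => (m.rowLen r : ℤ)

theorem rl_anti (m : YoungDiagram) : Antitone (rl m) := by
  intro a b h
  unfold rl
  exact_mod_cast m.rowLen_anti a b h

/-- Number of entries equal to `v` in row `r`. -/
def rc (lam : YoungDiagram) (T : ℕ × ℕ → ℕ) (r v : ℕ) : ℕ :=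
  ((Finset.range (lam.rowLen r)).filter fun c => T (r, c) = v).card

theorem mem_skew (lam mu : YoungDiagram) (r c : ℕ) :
    (r, c) ∈ skewCells lam mu ↔ c < lam.rowLen r ∧ ¬ c < mu.rowLen r := by
  unfold skewCells
  rw [Finset.mem_sdiff, mem_cells, mem_cells, mem_iff_lt_rowLen, mem_iff_lt_rowLen]

theorem fiber_card (lam : YoungDiagram) (Q : ℕ × ℕ → Prop) [DecidablePred Q] (r : ℕ) :
    ((lam.cells.filter Q).filter fun p => p.1 = r).card =
      ((Finset.range (lam.rowLen r)).filter fun c => Q (r, c)).card := by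
  refine Finset.card_bij' (fun p _ => p.2) (fun c _ => (r, c)) ?_ ?_ ?_ ?_
  · rintro ⟨a, b⟩ h
    simp only [Finset.mem_filter, mem_cells, mem_iff_lt_rowLen] at h
    obtain ⟨⟨h1, h2⟩, rfl⟩ := h
    simp [h1, h2]
  · intro c h
    simp only [Finset.mem_filter, Finset.mem_range] at h
    simp [mem_iff_lt_rowLen, h.1, h.2]
  · rintro ⟨a, b⟩ h
    simp only [Finset.mem_filter] at h
    rw [← h.2]
  · intro c h
    rfl

theorem rows_card (lam : YoungDiagram) (Q : ℕ × ℕ → Prop) [DecidablePred Q] (i : ℕ)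
    (hQ : ∀ p, p ∈ lam.cells → Q p → p.1 < i) :
    (lam.cells.filter Q).card =
      ∑ r ∈ Finset.range i, ((Finset.range (lam.rowLen r)).filter fun c => Q (r, c)).card := by
  rw [Finset.card_eq_sum_card_fiberwise (f := Prod.fst) (t := Finset.range i)]
  · exact Finset.sum_congr rfl fun r _ => fiber_card lam Q r
  · intro p hp
    rw [Finset.mem_coe, Finset.mem_filter] at hp
    exact Finset.mem_coe.2 (Finset.mem_range.2 (hQ p hp.1 hp.2))

theorem skew_filter {lam mu : YoungDiagram} {T : ℕ × ℕ → ℕ}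
    (hT : ∀ p, p ∈ skewCells lam mu ↔ T p ≠ 0) (Q : ℕ × ℕ → Prop) [DecidablePred Q] (v : ℕ) :
    (skewCells lam mu).filter (fun p => Q p ∧ T p = v + 1) =
      lam.cells.filter (fun p => Q p ∧ T p = v + 1) := by
  ext p
  simp only [Finset.mem_filter]
  constructor
  · rintro ⟨h1, h2⟩
    exact ⟨(Finset.mem_sdiff.1 h1).1, h2⟩
  · rintro ⟨h1, h2⟩
    exact ⟨(hT p).2 (by omega), h2⟩

theorem prefixCount_eq {lam mu : YoungDiagram} {T : ℕ × ℕ → ℕ}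
    (hT : ∀ p, p ∈ skewCells lam mu ↔ T p ≠ 0) (i j v : ℕ) :
    prefixCount lam mu T i j (v + 1) = ∑ r ∈ Finset.range i, rc lam T r (v + 1) +
      ((Finset.range (lam.rowLen i)).filter fun c => j ≤ c ∧ T (i, c) = v + 1).card := by
  unfold prefixCount
  rw [skew_filter hT (fun p => p.1 < i ∨ (p.1 = i ∧ j ≤ p.2)) v,
    rows_card lam _ (i + 1) (fun p _ h => by omega), Finset.sum_range_succ]
  congr 1
  · refine Finset.sum_congr rfl fun r hr => ?_
    rw [Finset.mem_range] at hr
    unfold rc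
    congr 1
    ext c
    simp [hr]
  · congr 1
    ext c
    simp

theorem content_eq {lam mu : YoungDiagram} {T : ℕ × ℕ → ℕ} {n : ℕ}
    (hn : ∀ r, n ≤ r → lam.rowLen r = 0)
    (hT : ∀ p, p ∈ skewCells lam mu ↔ T p ≠ 0) (v : ℕ) :
    content lam mu T (v + 1) = ∑ r ∈ Finset.range n, rc lam T r (v + 1) := by
  unfold content
  have := skew_filter hT (fun _ => True) v
  simp only [true_and] at this
  rw [this, rows_card lam _ n]
  · rfl
  · rintro ⟨a, b⟩ h _
    rw [mem_cells, mem_iff_lt_rowLen] at h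
    by_contra hc
    have := hn a (not_lt.1 hc)
    omega

/-- A tableau and a chain encode each other. -/
structure Rel (lam : YoungDiagram) (n : ℕ) (T : ℕ × ℕ → ℕ) (x : ℕ → ℕ → ℤ) : Prop where
  out : ∀ r c, lam.rowLen r ≤ c → T (r, c) = 0
  iff : ∀ r c, c < lam.rowLen r → ∀ k, k ≤ n → ((c : ℤ) < x (n + k) r ↔ T (r, c) ≤ k)

theorem Rel.le {lam : YoungDiagram} {n : ℕ} {T : ℕ × ℕ → ℕ} {x : ℕ → ℕ → ℤ}
    (h : Rel lam n T x) (hx : IsChain (rl lam) (n + n) x) (r c : ℕ) : T (r, c) ≤ n := by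
  by_cases hc : c < lam.rowLen r
  · rw [← h.iff r c hc n le_rfl, hx.top _ le_rfl]
    unfold rl
    exact_mod_cast hc
  · rw [h.out r c (not_lt.1 hc)]
    omega

theorem Rel.rc_eq {lam : YoungDiagram} {n : ℕ} {T : ℕ × ℕ → ℕ} {x : ℕ → ℕ → ℤ}
    (h : Rel lam n T x) (hx : IsChain (rl lam) (n + n) x) (r k : ℕ) (hk : k < n) :
    (rc lam T r (k + 1) : ℤ) = x (n + k + 1) r - x (n + k) r := by
  have e : (Finset.range (lam.rowLen r)).filter (fun c => T (r, c) = k + 1) =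
      Finset.Ico (x (n + k) r).toNat (x (n + k + 1) r).toNat := by
    ext c
    rw [Finset.mem_filter, Finset.mem_range, Finset.mem_Ico]
    have h3 : x (n + k + 1) r ≤ (lam.rowLen r : ℤ) := hx.le _ _
    constructor
    · rintro ⟨h1, h2⟩
      have a := h.iff r c h1 k (by omega)
      have b := h.iff r c h1 (k + 1) (by omega)
      rw [← Nat.add_assoc] at b
      omega
    · rintro ⟨h1, h2⟩
      have hc : c < lam.rowLen r := by omega
      have a := h.iff r c hc k (by omega)
      have b := h.iff r c hc (k + 1) (by omega)
      rw [← Nat.add_assoc] at b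
      omega
  unfold rc
  rw [e, Nat.card_Ico]
  have := hx.nonneg (n + k) r
  have := hx.up (n + k) r
  omega

theorem Rel.sum_rc {lam : YoungDiagram} {n : ℕ} {T : ℕ × ℕ → ℕ} {x : ℕ → ℕ → ℤ}
    (h : Rel lam n T x) (hx : IsChain (rl lam) (n + n) x) (k : ℕ) (hk : k < n) (m : ℕ) :
    ((∑ r ∈ Finset.range m, rc lam T r (k + 1) : ℕ) : ℤ) =
      psum x (n + k + 1) m - psum x (n + k) m := by
  unfold psum
  rw [← Finset.sum_sub_distrib]
  push_cast
  exact Finset.sum_congr rfl fun r _ => h.rc_eq hx r k hk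

theorem Rel.unique_T {lam : YoungDiagram} {n : ℕ} {T T' : ℕ × ℕ → ℕ} {x : ℕ → ℕ → ℤ}
    (h : Rel lam n T x) (h' : Rel lam n T' x) (hx : IsChain (rl lam) (n + n) x) : T = T' := by
  funext p
  obtain ⟨r, c⟩ := p
  by_cases hc : c < lam.rowLen r
  · have a := h.le hx r c
    have b := h'.le hx r c
    have e1 := h.iff r c hc _ a
    have e2 := h'.iff r c hc _ a
    have e3 := h.iff r c hc _ b
    have e4 := h'.iff r c hc _ b
    have : T (r, c) ≤ T' (r, c) := e3.1 (e4.2 le_rfl)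
    have : T' (r, c) ≤ T (r, c) := e2.1 (e1.2 le_rfl)
    omega
  · rw [h.out r c (not_lt.1 hc), h'.out r c (not_lt.1 hc)]

theorem Rel.unique_x {lam : YoungDiagram} {n : ℕ} {T : ℕ × ℕ → ℕ} {x y : ℕ → ℕ → ℤ}
    {u v v' : ℕ → ℤ}
    (h : Rel lam n T x) (h' : Rel lam n T y) (hx : IsChain (rl lam) (n + n) x)
    (hy : IsChain (rl lam) (n + n) y) (gx : Good n u v x) (gy : Good n u v' y) : x = y := by
  funext k r
  by_cases hk : k ≤ n
  · rw [forced hx gx.1 gx.2.2.1 k hk, forced hy gy.1 gy.2.2.1 k hk]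
  · by_cases hk' : n + n ≤ k
    · rw [hx.top k hk', hy.top k hk']
    · obtain ⟨d, rfl⟩ : ∃ d, k = n + d := ⟨k - n, by omega⟩
      have a1 := hx.nonneg (n + d) r
      have a2 : x (n + d) r ≤ (lam.rowLen r : ℤ) := hx.le (n + d) r
      have b1 := hy.nonneg (n + d) r
      have b2 : y (n + d) r ≤ (lam.rowLen r : ℤ) := hy.le (n + d) r
      rcases lt_trichotomy (x (n + d) r) (y (n + d) r) with hlt | heq | hlt
      · have c1 := h.iff r (x (n + d) r).toNat (by omega) d (by omega)
        have c2 := h'.iff r (x (n + d) r).toNat (by omega) d (by omega)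
        omega
      · exact heq
      · have c1 := h.iff r (y (n + d) r).toNat (by omega) d (by omega)
        have c2 := h'.iff r (y (n + d) r).toNat (by omega) d (by omega)
        omega

/-- The tableau of a chain. -/
noncomputable def toTab (lam : YoungDiagram) (n : ℕ) (x : ℕ → ℕ → ℤ) : ℕ × ℕ → ℕ := fun p =>
  if p.2 < lam.rowLen p.1 then
    ((Finset.range n).filter fun k => x (n + k) p.1 ≤ (p.2 : ℤ)).card else 0

theorem lt_card_filter (m : ℕ) (p : ℕ → Prop) [DecidablePred p] (hp : ∀ a b, a ≤ b → b < m → p b → p a) (c : ℕ)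
    (hc : c < m) : c < ((Finset.range m).filter p).card ↔ p c := by
  constructor
  · intro h
    by_contra hn
    have : (Finset.range m).filter p ⊆ Finset.range c := by
      intro a ha
      rw [Finset.mem_filter, Finset.mem_range] at ha
      rw [Finset.mem_range]
      by_contra hac
      exact hn (hp c a (not_lt.1 hac) ha.1 ha.2)
    have := Finset.card_le_card this
    rw [Finset.card_range] at this
    omega
  · intro h
    have : Finset.range (c + 1) ⊆ (Finset.range m).filter p := by
      intro a ha
      rw [Finset.mem_range] at ha
      rw [Finset.mem_filter, Finset.mem_range]
      exact ⟨by omega, hp a c (by omega) hc h⟩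
    have := Finset.card_le_card this
    rw [Finset.card_range] at this
    omega

theorem rel_toTab {lam : YoungDiagram} {n : ℕ} {x : ℕ → ℕ → ℤ}
    (hx : IsChain (rl lam) (n + n) x) : Rel lam n (toTab lam n x) x := by
  refine ⟨?_, ?_⟩
  · intro r c h
    simp [toTab, h]
  · intro r c hc k hk
    simp only [toTab, hc, if_true]
    rcases Nat.lt_or_ge k n with h | h
    · have := lt_card_filter n (fun k => x (n + k) r ≤ (c : ℤ)) (by
        intro a b hab _ h
        exact (hx.mono r (show n + a ≤ n + b by omega)).trans h) k h
      omega
    · obtain rfl : k = n := by omega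
      have h1 : x (k + k) r = (lam.rowLen r : ℤ) := hx.top _ le_rfl r
      have h2 := Finset.card_filter_le (Finset.range k) (fun j => x (k + j) r ≤ (c : ℤ))
      rw [Finset.card_range] at h2
      omega

theorem Rel.isLR {lam mu nu : YoungDiagram} {n : ℕ} {T : ℕ × ℕ → ℕ} {x : ℕ → ℕ → ℤ}
    (h1 : ∀ r, n ≤ r → lam.rowLen r = 0) (h2 : ∀ r, n ≤ r → mu.rowLen r = 0)
    (h3 : ∀ r, n ≤ r → nu.rowLen r = 0)
    (h : Rel lam n T x) (hx : IsChain (rl lam) (n + n) x) (g : Good n (rl mu) (rl nu) x) :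
    IsLR lam mu nu T := by
  have hmid : ∀ r, x n r = (mu.rowLen r : ℤ) := by
    intro r
    rw [forced hx g.1 g.2.2.1 n le_rfl]
    split_ifs with hr
    · rfl
    · rw [h2 r (not_lt.1 hr)]; rfl
  have hT : ∀ p, p ∈ skewCells lam mu ↔ T p ≠ 0 := by
    rintro ⟨r, c⟩
    rw [mem_skew]
    by_cases hc : c < lam.rowLen r
    · have := h.iff r c hc 0 (by omega)
      rw [Nat.add_zero, hmid] at this
      omega
    · have := h.out r c (not_lt.1 hc)
      omega
  have hle := h.le hx
  refine ⟨⟨hT, ?_, ?_⟩, ?_, ?_⟩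
  · intro i j1 j2 m1 m2 hj
    rw [mem_skew] at m1 m2
    rw [← h.iff i j1 m1.1 _ (hle i j2)]
    have := (h.iff i j2 m2.1 _ (hle i j2)).2 le_rfl
    omega
  · intro i1 i2 j m1 m2 hi
    induction i2, hi using Nat.le_induction with
    | base =>
      change (i1 + 1, j) ∈ skewCells lam mu at m2
      have t2 := (hT _).1 m2
      have hle2 := hle (i1 + 1) j
      rw [mem_skew] at m1 m2
      obtain ⟨k, hk⟩ : ∃ k, T (i1 + 1, j) = k + 1 := ⟨T (i1 + 1, j) - 1, by omega⟩
      have a := (h.iff (i1 + 1) j m2.1 (k + 1) (by omega)).2 (by omega)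
      have b : x (n + (k + 1)) (i1 + 1) ≤ x (n + k) i1 := hx.il (n + k) i1
      have := (h.iff i1 j m1.1 k (by omega)).1 (by omega)
      show T (i1, j) < T (i1 + 1, j)
      omega
    | succ i2 hi ih =>
      have m3 : (i2, j) ∈ skewCells lam mu := by
        rw [mem_skew] at m1 m2 ⊢
        have a := lam.rowLen_anti i2 (i2 + 1) (by omega)
        have b := mu.rowLen_anti i1 i2 (by omega)
        omega
      refine (ih m3).trans ?_
      have t2 := (hT _).1 m2
      have hle2 := hle (i2 + 1) j
      rw [mem_skew] at m3 m2
      obtain ⟨k, hk⟩ : ∃ k, T (i2 + 1, j) = k + 1 := ⟨T (i2 + 1, j) - 1, by omega⟩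
      have a := (h.iff (i2 + 1) j m2.1 (k + 1) (by omega)).2 (by omega)
      have b : x (n + (k + 1)) (i2 + 1) ≤ x (n + k) i2 := hx.il (n + k) i2
      have := (h.iff i2 j m3.1 k (by omega)).1 (by omega)
      omega
  · intro i j k
    by_cases hk : k + 2 ≤ n
    · rw [prefixCount_eq hT, prefixCount_eq hT i j k]
      have a : ((Finset.range (lam.rowLen i)).filter fun c => j ≤ c ∧ T (i, c) = k + 1 + 1).card
          ≤ rc lam T i (k + 1 + 1) := by
        apply Finset.card_le_card
        intro c
        simp only [Finset.mem_filter]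
        tauto
      have b := g.2.1 (n + k) (by omega) (by omega) i
      unfold Viol at b
      have s1 := h.sum_rc hx k (by omega) i
      have s2 := h.sum_rc hx (k + 1) (by omega) (i + 1)
      rw [Finset.sum_range_succ] at s2
      rw [show n + (k + 1) + 1 = n + k + 2 by omega, show n + (k + 1) = n + k + 1 by omega] at s2
      omega
    · have : prefixCount lam mu T i j (k + 2) = 0 := by
        unfold prefixCount
        rw [Finset.card_eq_zero, Finset.filter_eq_empty_iff]
        rintro ⟨r, c⟩ _ ⟨_, hc⟩
        have := hle r c
        omega
      omega
  · intro i
    by_cases hi : i < n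
    · have a := g.2.2.2 i hi
      have b := h.sum_rc hx i hi n
      rw [← content_eq h1 hT i] at b
      unfold wt rl at a
      rw [a] at b
      exact_mod_cast b
    · rw [h3 i (not_lt.1 hi)]
      unfold content
      rw [Finset.card_eq_zero, Finset.filter_eq_empty_iff]
      rintro ⟨r, c⟩ _ hc
      have := hle r c
      omega

/-- The chain of a tableau. -/
noncomputable def toChain (lam mu : YoungDiagram) (n : ℕ) (T : ℕ × ℕ → ℕ) : ℕ → ℕ → ℤ :=
  fun k r => if k < n then (if r < k then (mu.rowLen r : ℤ) else 0) else
    (((Finset.range (lam.rowLen r)).filter fun c => T (r, c) ≤ k - n).card : ℤ)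

theorem exists_chain {lam mu nu : YoungDiagram} {n : ℕ} {T : ℕ × ℕ → ℕ} (hn : 0 < n)
    (h1 : ∀ r, n ≤ r → lam.rowLen r = 0) (h2 : ∀ r, n ≤ r → mu.rowLen r = 0)
    (h3 : ∀ r, n ≤ r → nu.rowLen r = 0) (hml : mu ≤ lam) (hT : IsLR lam mu nu T) :
    ∃ x, IsChain (rl lam) (n + n) x ∧ Good n (rl mu) (rl nu) x ∧ Rel lam n T x := by
  obtain ⟨⟨hT0, hT1, hT2⟩, hT3, hT4⟩ := hT
  have hmlr : ∀ r, mu.rowLen r ≤ lam.rowLen r := by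
    intro r
    by_contra hc
    have : (r, lam.rowLen r) ∈ mu := mem_iff_lt_rowLen.2 (not_le.1 hc)
    have := mem_iff_lt_rowLen.1 (hml this)
    omega
  have hle : ∀ r c, T (r, c) ≤ n := by
    intro r c
    by_contra hc
    obtain ⟨v, hv⟩ : ∃ v, T (r, c) = v + 1 := ⟨T (r, c) - 1, by omega⟩
    have a := hT4 v
    rw [h3 v (by omega)] at a
    unfold content at a
    rw [Finset.card_eq_zero, Finset.filter_eq_empty_iff] at a
    exact a ((hT0 (r, c)).2 (by omega)) hv
  have hz : ∀ r c, c < lam.rowLen r → (T (r, c) = 0 ↔ c < mu.rowLen r) := by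
    intro r c hc
    have := hT0 (r, c)
    rw [mem_skew] at this
    omega
  set x := toChain lam mu n T with hxdef
  have hxn : ∀ k r, x (n + k) r =
      (((Finset.range (lam.rowLen r)).filter fun c => T (r, c) ≤ k).card : ℤ) := by
    intro k r
    simp [hxdef, toChain]
  have hR : Rel lam n T x := by
    refine ⟨?_, ?_⟩
    · intro r c hc
      have := hT0 (r, c)
      rw [mem_skew] at this
      omega
    · intro r c hc k hk
      rw [hxn]
      rw [Nat.cast_lt]
      refine lt_card_filter _ (fun c => T (r, c) ≤ k) ?_ c hc
      intro a b hab hb hTb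
      show T (r, a) ≤ k
      by_cases ha : a < mu.rowLen r
      · rw [(hz r a (by omega)).2 ha]; omega
      · refine (hT1 r a b ?_ ?_ hab).trans hTb
        · rw [mem_skew]; omega
        · rw [mem_skew]; omega
  have hlow : ∀ k r, k ≤ n → x k r = if r < k then (mu.rowLen r : ℤ) else 0 := by
    intro k r hk
    rcases Nat.lt_or_ge k n with h | h
    · simp [hxdef, toChain, h]
    · obtain rfl : k = n := by omega
      have e := hxn 0 r
      rw [Nat.add_zero] at e
      have e2 : (Finset.range (lam.rowLen r)).filter (fun c => T (r, c) ≤ 0) =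
          Finset.range (mu.rowLen r) := by
        ext c
        rw [Finset.mem_filter, Finset.mem_range, Finset.mem_range]
        have := hmlr r
        constructor
        · rintro ⟨a, b⟩
          exact (hz r c a).1 (by omega)
        · intro a
          have := (hz r c (by omega)).2 a
          omega
      rw [e, e2, Finset.card_range]
      split_ifs with hr
      · rfl
      · rw [h2 r (not_lt.1 hr)]; rfl
  have hanti : ∀ r, mu.rowLen (r + 1) ≤ mu.rowLen r := fun r => mu.rowLen_anti _ _ (by omega)
  have hC : IsChain (rl lam) (n + n) x := by
    refine ⟨?_, ?_, ?_, ?_⟩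
    · intro r
      rw [hlow 0 r (by omega)]
      simp
    · intro k hk r
      obtain ⟨d, rfl⟩ : ∃ d, k = n + d := ⟨k - n, by omega⟩
      rw [hxn, Finset.filter_true_of_mem, Finset.card_range]
      · rfl
      · intro c _
        have := hle r c
        omega
    · intro k r
      rcases Nat.lt_or_ge k n with h | h
      · rw [hlow k r (by omega), hlow (k + 1) r (by omega)]
        split_ifs <;> omega
      · obtain ⟨d, rfl⟩ : ∃ d, k = n + d := ⟨k - n, by omega⟩
        rw [Nat.add_assoc, hxn, hxn, Nat.cast_le]
        apply Finset.card_le_card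
        intro c
        simp only [Finset.mem_filter]
        rintro ⟨a, b⟩
        exact ⟨a, by omega⟩
    · intro k r
      rcases Nat.lt_or_ge k n with h | h
      · rw [hlow k r (by omega), hlow (k + 1) (r + 1) (by omega)]
        have := hanti r
        split_ifs <;> omega
      · obtain ⟨d, rfl⟩ : ∃ d, k = n + d := ⟨k - n, by omega⟩
        rw [Nat.add_assoc, hxn, hxn, Nat.cast_le]
        apply Finset.card_le_card
        intro c
        simp only [Finset.mem_filter, Finset.mem_range]
        rintro ⟨a, b⟩
        have e1 := lam.rowLen_anti r (r + 1) (by omega)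
        have e2 := hanti r
        refine ⟨by omega, ?_⟩
        by_cases e3 : c < mu.rowLen r
        · rw [(hz r c (by omega)).2 e3]; omega
        · have := hT2 r (r + 1) c (by rw [mem_skew]; omega) (by rw [mem_skew]; omega) (by omega)
          omega
  have hps : ∀ k m, k < n → psum x (k + 1) m - psum x k m =
      if k < m then (mu.rowLen k : ℤ) else 0 := by
    intro k m hk
    induction m with
    | zero => simp [psum_zero]
    | succ m ih =>
      rw [psum_succ, psum_succ, hlow (k + 1) m (by omega), hlow k m (by omega)]
      rcases lt_trichotomy m k with h | h | h
      · rw [if_neg (by omega)] at ih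
        rw [if_pos (by omega), if_pos h, if_neg (by omega)]
        omega
      · subst h
        rw [if_neg (by omega)] at ih
        simp only [lt_irrefl, if_false, Nat.lt_succ_self, if_true]
        omega
      · rw [if_pos (by omega)] at ih
        rw [if_neg (by omega), if_neg (by omega), if_pos (by omega)]
        omega
  refine ⟨x, hC, ⟨?_, ?_, ?_, ?_⟩, hR⟩
  · intro l _ hl i
    unfold Viol
    have a := hps (l + 1) (i + 1) (by omega)
    have b := hps l i (by omega)
    rw [b, show l + 2 = l + 1 + 1 by omega, a]
    have := hanti l
    split_ifs <;> omega
  · intro l hl1 hl2 i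
    obtain ⟨k, rfl⟩ : ∃ k, l = n + k := ⟨l - n, by omega⟩
    have a := hT3 i (x (n + k + 1) i).toNat k
    rw [prefixCount_eq hT0, prefixCount_eq hT0 i _ k] at a
    have e1 : ((Finset.range (lam.rowLen i)).filter fun c =>
        (x (n + k + 1) i).toNat ≤ c ∧ T (i, c) = k + 1) = ∅ := by
      rw [Finset.filter_eq_empty_iff]
      rintro c hc ⟨b1, b2⟩
      rw [Finset.mem_range] at hc
      have := (hR.iff i c hc (k + 1) (by omega)).2 (by omega)
      rw [← Nat.add_assoc] at this
      omega
    have e2 : ((Finset.range (lam.rowLen i)).filter fun c =>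
        (x (n + k + 1) i).toNat ≤ c ∧ T (i, c) = k + 1 + 1).card = rc lam T i (k + 1 + 1) := by
      unfold rc
      congr 1
      ext c
      simp only [Finset.mem_filter, Finset.mem_range]
      constructor
      · rintro ⟨b1, b2, b3⟩
        exact ⟨b1, b3⟩
      · rintro ⟨b1, b3⟩
        refine ⟨b1, ?_, b3⟩
        have := hR.iff i c b1 (k + 1) (by omega)
        rw [← Nat.add_assoc] at this
        omega
    rw [e1, e2, Finset.card_empty, ← Finset.sum_range_succ (fun r => rc lam T r (k + 1 + 1))] at a
    have s1 := hR.sum_rc hC k (by omega) i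
    have s2 := hR.sum_rc hC (k + 1) (by omega) (i + 1)
    rw [show n + (k + 1) + 1 = n + k + 2 by omega, show n + (k + 1) = n + k + 1 by omega] at s2
    unfold Viol
    omega
  · intro i hi
    unfold wt
    rw [hps i n hi, if_pos hi]
    rfl
  · intro i hi
    have b := hR.sum_rc hC i hi n
    rw [← content_eq h1 hT0 i, hT4] at b
    unfold wt
    rw [← b]
    rfl

theorem lrCoeff_eq {lam mu nu : YoungDiagram} {n : ℕ} (hn : 0 < n)
    (h1 : ∀ r, n ≤ r → lam.rowLen r = 0) (h2 : ∀ r, n ≤ r → mu.rowLen r = 0)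
    (h3 : ∀ r, n ≤ r → nu.rowLen r = 0)
    (C : Finset (ℕ → ℕ → ℤ)) (hC : ∀ x, x ∈ C ↔ IsChain (rl lam) (n + n) x) :
    lrCoeff lam mu nu = (C.filter (Good n (rl mu) (rl nu))).card := by
  unfold lrCoeff
  split_ifs with hml
  · rw [← Set.ncard_coe_finset]
    symm
    refine Set.ncard_congr (fun x _ => toTab lam n x) ?_ ?_ ?_
    · intro x hx
      rw [Finset.mem_coe, Finset.mem_filter, hC] at hx
      exact (rel_toTab hx.1).isLR h1 h2 h3 hx.1 hx.2
    · intro x y hx hy hxy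
      rw [Finset.mem_coe, Finset.mem_filter, hC] at hx hy
      have a := rel_toTab hx.1
      have b := rel_toTab hy.1
      rw [← hxy] at b
      exact a.unique_x b hx.1 hy.1 hx.2 hy.2
    · intro T hT
      obtain ⟨x, c, g, r⟩ := exists_chain hn h1 h2 h3 hml hT
      refine ⟨x, ?_, (rel_toTab c).unique_T r c⟩
      rw [Finset.mem_coe, Finset.mem_filter, hC]
      exact ⟨c, g⟩
  · symm
    rw [Finset.card_eq_zero, Finset.filter_eq_empty_iff]
    intro x hx g
    rw [hC] at hx
    apply hml
    rintro ⟨r, c⟩ hrc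
    rw [mem_iff_lt_rowLen] at hrc ⊢
    have a := forced hx g.1 g.2.2.1 n le_rfl r
    by_cases hr : r < n
    · rw [if_pos hr] at a
      have b := hx.le n r
      rw [a] at b
      unfold rl at b
      omega
    · rw [h2 r (not_lt.1 hr)] at hrc
      omega

theorem rowLen_zero (m : YoungDiagram) (r : ℕ) (h : m.colLen 0 ≤ r) : m.rowLen r = 0 := by
  by_contra hc
  have h1 : (r, 0) ∈ m := mem_iff_lt_rowLen.2 (Nat.pos_of_ne_zero hc)
  have := mem_iff_lt_colLen.1 h1
  omega

/-- the LR coefficient is symmetric in its two lower arguments. -/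
theorem lrCoeff_symm (lam mu : YoungDiagram) (hmu : mu ≤ lam) (nu : YoungDiagram) :
    lrCoeff lam mu nu = lrCoeff lam nu mu := by
  obtain ⟨n, hn⟩ : ∃ n, n = lam.colLen 0 + mu.colLen 0 + nu.colLen 0 + 1 := ⟨_, rfl⟩
  have h1 : ∀ r, n ≤ r → lam.rowLen r = 0 := fun r hr => rowLen_zero lam r (by omega)
  have h2 : ∀ r, n ≤ r → mu.rowLen r = 0 := fun r hr => rowLen_zero mu r (by omega)
  have h3 : ∀ r, n ≤ r → nu.rowLen r = 0 := fun r hr => rowLen_zero nu r (by omega)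
  have hL : ∀ r, n ≤ r → rl lam r = 0 := fun r hr => by unfold rl; rw [h1 r hr]; rfl
  have hC : ∀ x, x ∈ (finite_chain (rl lam) (n + n) n hL).toFinset ↔
      IsChain (rl lam) (n + n) x := fun x => by simp
  rw [lrCoeff_eq (by omega) h1 h2 h3 _ hC, lrCoeff_eq (by omega) h1 h3 h2 _ hC]
  exact good_card_symm (by omega) hL _ hC _ _ (rl_anti mu) (rl_anti nu)

end LRSkew
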